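/- (Canonical frame properties) Let Ax ⊆ L⇛ be consistent, Σ ⊆ L⇛ contain ⊤ and be closed under subformulas, and let F_{Ax,Σ} = (SEG_{Ax,Σ}, ≼, R) be the full canonical frame. Then: (1) if Σ is closed under single negations and em := p∨¬p ∈ Ax, then ≼ is symmetric; (2) if t□ := (⊤⇛p)→p ∈ Ax, then for every (Γ,U) ∈ SEG_{Ax,Σ} there exists (Δ,D) with (Γ,U) ≼ (Δ,D) and (Δ,D) R (Γ,U); (3) if str := (p→q)→(p⇛q) ∈ Ax, then (Γ,U) R (Γ',U') implies (Γ,U) ≼ (Γ',U'); (4) if Σ = L⇛ and p_a := (p⇛q)→(⊤⇛(p⇛q)) ∈ Ax, then for all segments w, v, s with w R v R s there exists u ≽ w such that u R s and R[u] ⊆ R[v]. -/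

import Mathlib

/-- Formulas of the language `L⇛`. -/
inductive Fml : Type where
  | var : Nat → Fml
  | top : Fml
  | bot : Fml
  | and : Fml → Fml → Fml
  | or  : Fml → Fml → Fml
  | imp : Fml → Fml → Fml
  | sto : Fml → Fml → Fml
deriving DecidableEq

/-- Uniform substitution. -/
def Fml.subst (σ : Nat → Fml) : Fml → Fml
  | .var p => σ p
  | .top => .top
  | .bot => .bot
  | .and φ ψ => .and (φ.subst σ) (ψ.subst σ)
  | .or φ ψ => .or (φ.subst σ) (ψ.subst σ)
  | .imp φ ψ => .imp (φ.subst σ) (ψ.subst σ)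
  | .sto φ ψ => .sto (φ.subst σ) (ψ.subst σ)

/-- Conjunction `φ₁ ∧ ⋯ ∧ φₙ` of a list of formulas (`⊤` for the empty list). -/
def Fml.conj : List Fml → Fml
  | [] => .top
  | [φ] => φ
  | φ :: ψ :: rest => .and φ (Fml.conj (ψ :: rest))

/-- Disjunction `φ₁ ∨ ⋯ ∨ φₙ` of a list of formulas (`⊥` for the empty list). -/
def Fml.disj : List Fml → Fml
  | [] => .bot
  | [φ] => φ
  | φ :: ψ :: rest => .or φ (Fml.disj (ψ :: rest))

/-- Axiom schemes of intuitionistic propositional logic (a standard Hilbert-style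
axiomatisation); as schemes, they comprise all substitution instances. -/
inductive IpcAx : Fml → Prop where
  | k (φ ψ : Fml) : IpcAx (.imp φ (.imp ψ φ))
  | s (φ ψ χ : Fml) : IpcAx (.imp (.imp φ (.imp ψ χ)) (.imp (.imp φ ψ) (.imp φ χ)))
  | andE1 (φ ψ : Fml) : IpcAx (.imp (.and φ ψ) φ)
  | andE2 (φ ψ : Fml) : IpcAx (.imp (.and φ ψ) ψ)
  | andI (φ ψ : Fml) : IpcAx (.imp φ (.imp ψ (.and φ ψ)))
  | orI1 (φ ψ : Fml) : IpcAx (.imp φ (.or φ ψ))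
  | orI2 (φ ψ : Fml) : IpcAx (.imp ψ (.or φ ψ))
  | orE (φ ψ χ : Fml) : IpcAx (.imp (.imp φ χ) (.imp (.imp ψ χ) (.imp (.or φ ψ) χ)))
  | botE (φ : Fml) : IpcAx (.imp .bot φ)
  | top : IpcAx .top

/-- Substitution instances of the axioms of intuitionistic logic together with
`k_a : ((p⇛q)∧(p⇛r))→(p⇛(q∧r))` and `tr : ((p⇛q)∧(q⇛r))→(p⇛r)`. -/
inductive BaseAx : Fml → Prop where
  | ipc {φ : Fml} : IpcAx φ → BaseAx φ
  | ka (φ ψ χ : Fml) : BaseAx (.imp (.and (.sto φ ψ) (.sto φ χ)) (.sto φ (.and ψ χ)))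
  | tr (φ ψ χ : Fml) : BaseAx (.imp (.and (.sto φ ψ) (.sto ψ χ)) (.sto φ χ))

/-- Derivability of the consecution `Γ ⇒ φ` in `HLC♭ ⊕ Ax`, i.e. `Γ ⊢_Ax φ`. -/
inductive Deriv (Ax : Set Fml) : Set Fml → Fml → Prop where
  | base {Γ : Set Fml} {φ : Fml} : BaseAx φ → Deriv Ax Γ φ
  | axm {Γ : Set Fml} {ψ : Fml} (σ : Nat → Fml) : ψ ∈ Ax → Deriv Ax Γ (ψ.subst σ)
  | el {Γ : Set Fml} {φ : Fml} : φ ∈ Γ → Deriv Ax Γ φ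
  | mp {Γ : Set Fml} {φ ψ : Fml} : Deriv Ax Γ φ → Deriv Ax Γ (.imp φ ψ) → Deriv Ax Γ ψ
  | na {Γ : Set Fml} {φ ψ : Fml} : Deriv Ax (∅ : Set Fml) (.imp φ ψ) → Deriv Ax Γ (.sto φ ψ)

/-- `em := p ∨ ¬p` (where `¬φ` abbreviates `φ→⊥`). -/
def emFml : Fml := .or (.var 0) (.imp (.var 0) .bot)
/-- `t□ := (⊤⇛p)→p`. -/
def tbFml : Fml := .imp (.sto .top (.var 0)) (.var 0)
/-- `str := (p→q)→(p⇛q)`. -/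
def strFml : Fml := .imp (.imp (.var 0) (.var 1)) (.sto (.var 0) (.var 1))
/-- `p_a := (p⇛q)→(⊤⇛(p⇛q))`. -/
def paFml : Fml := .imp (.sto (.var 0) (.var 1)) (.sto .top (.sto (.var 0) (.var 1)))
/-- `4a := p⇛(⊤⇛p)`. -/
def fourAFml : Fml := .sto (.var 0) (.sto .top (.var 0))
/-- `di := ((p⇛r)∧(q⇛r))→((p∨q)⇛r)`. -/
def diFml : Fml := .imp (.and (.sto (.var 0) (.var 2)) (.sto (.var 1) (.var 2)))
    (.sto (.or (.var 0) (.var 1)) (.var 2))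

/-- `Γ ⊢_Ax Δ`: there are `ψ₁, …, ψₘ ∈ Δ` (m ≥ 1) with `Γ ⊢_Ax ψ₁ ∨ ⋯ ∨ ψₘ`. -/
def DerivDisj (Ax Γ Δ : Set Fml) : Prop :=
  ∃ L : List Fml, L ≠ [] ∧ (∀ ψ ∈ L, ψ ∈ Δ) ∧ Deriv Ax Γ (Fml.disj L)

/-- A set of axioms is consistent if it does not derive `⊥`. -/
def Consistent (Ax : Set Fml) : Prop := ¬ Deriv Ax (∅ : Set Fml) .bot

/-- A prime `Ax`-theory: deductively closed, consistent, and prime. -/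
def IsPrimeTheory (Ax Γ : Set Fml) : Prop :=
  (∀ φ, Deriv Ax Γ φ → φ ∈ Γ) ∧
  ¬ Deriv Ax Γ .bot ∧
  (∀ L : List Fml, L ≠ [] → Deriv Ax Γ (Fml.disj L) → ∃ φ ∈ L, φ ∈ Γ)

/-- `S` is closed under subformulas. -/
def SubfClosed (S : Set Fml) : Prop :=
  (∀ φ ψ : Fml, Fml.and φ ψ ∈ S → φ ∈ S ∧ ψ ∈ S) ∧
  (∀ φ ψ : Fml, Fml.or φ ψ ∈ S → φ ∈ S ∧ ψ ∈ S) ∧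
  (∀ φ ψ : Fml, Fml.imp φ ψ ∈ S → φ ∈ S ∧ ψ ∈ S) ∧
  (∀ φ ψ : Fml, Fml.sto φ ψ ∈ S → φ ∈ S ∧ ψ ∈ S)

/-- A prime `(Ax,S)`-theory: a subset of `S` that is deductively closed within `S`,
consistent, and `S`-prime. -/
def PrimeTheoryIn (Ax S Γ : Set Fml) : Prop :=
  Γ ⊆ S ∧
  (∀ φ ∈ S, Deriv Ax Γ φ → φ ∈ Γ) ∧
  ¬ Deriv Ax Γ .bot ∧
  (∀ L : List Fml, L ≠ [] → (∀ ψ ∈ L, ψ ∈ S) → Deriv Ax Γ (Fml.disj L) →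
    ∃ φ ∈ L, φ ∈ Γ)

/-- `(Γ, U)` is an `(Ax,S)`-segment: `Γ` and all members of `U` are prime
`(Ax,S)`-theories, `U` is closed upwards under inclusion among prime
`(Ax,S)`-theories (S1), and for all `φ, ψ ∈ S`, if `Γ ⊢_Ax φ⇛ψ` and `φ` belongs to
every member of `U`, then so does `ψ` (S2). -/
def IsSegment (Ax S : Set Fml) (Γ : Set Fml) (U : Set (Set Fml)) : Prop :=
  PrimeTheoryIn Ax S Γ ∧
  (∀ Δ ∈ U, PrimeTheoryIn Ax S Δ) ∧
  (∀ Δ ∈ U, ∀ Δ', PrimeTheoryIn Ax S Δ' → Δ ⊆ Δ' → Δ' ∈ U) ∧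
  (∀ φ ψ : Fml, φ ∈ S → ψ ∈ S → Deriv Ax Γ (.sto φ ψ) →
    (∀ Δ ∈ U, φ ∈ Δ) → ∀ Δ ∈ U, ψ ∈ Δ)

/-- The type of `(Ax,S)`-segments. -/
def Segment (Ax S : Set Fml) : Type :=
  {p : Set Fml × Set (Set Fml) // IsSegment Ax S p.1 p.2}

/-- Truth at a segment `(Γ,U)` of the full canonical model `M_{Ax,S}`:
`(Γ,U) ≼ (Γ',U')` iff `Γ ⊆ Γ'`, `(Γ,U) R (Γ',U')` iff `Γ' ∈ U`, and
`V(p) = {(Γ,U) | p ∈ Γ}`. -/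
def canonSat (Ax S : Set Fml) : Fml → Segment Ax S → Prop
  | .var p, w => Fml.var p ∈ w.1.1
  | .top, _ => True
  | .bot, _ => False
  | .and φ ψ, w => canonSat Ax S φ w ∧ canonSat Ax S ψ w
  | .or φ ψ, w => canonSat Ax S φ w ∨ canonSat Ax S ψ w
  | .imp φ ψ, w => ∀ v : Segment Ax S, w.1.1 ⊆ v.1.1 →
      canonSat Ax S φ v → canonSat Ax S ψ v
  | .sto φ ψ, w => ∀ w' : Segment Ax S, w.1.1 ⊆ w'.1.1 →
      (∀ v : Segment Ax S, v.1.1 ∈ w'.1.2 → canonSat Ax S φ v) →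
      ∀ v : Segment Ax S, v.1.1 ∈ w'.1.2 → canonSat Ax S ψ v

/-- The single negation `∼φ`: `ψ` if `φ = ¬ψ`, and `¬φ` otherwise. -/
def Fml.sneg : Fml → Fml
  | .imp ψ .bot => ψ
  | φ => .imp φ .bot

/-- `S` is closed under single negations. -/
def SnClosed (S : Set Fml) : Prop := ∀ φ ∈ S, Fml.sneg φ ∈ S

namespace Deriv

variable {Ax Γ Γ' : Set Fml} {φ ψ χ : Fml}

theorem mono (h : Deriv Ax Γ φ) (hΓ : Γ ⊆ Γ') : Deriv Ax Γ' φ := by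
  induction h with
  | base h => exact base h
  | axm σ h => exact axm σ h
  | el h => exact el (hΓ h)
  | mp _ _ ih₁ ih₂ => exact mp (ih₁ hΓ) (ih₂ hΓ)
  | na h _ => exact na h

theorem weaken (h : Deriv Ax ∅ φ) : Deriv Ax Γ φ :=
  h.mono (Set.empty_subset Γ)

theorem ipc (h : IpcAx φ) : Deriv Ax Γ φ := base (.ipc h)

theorem imp_intro (χ : Fml) (h : Deriv Ax Γ φ) : Deriv Ax Γ (.imp χ φ) :=
  mp h (ipc (.k φ χ))

theorem imp_mp (h₁ : Deriv Ax Γ (.imp χ φ)) (h₂ : Deriv Ax Γ (.imp χ (.imp φ ψ))) :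
    Deriv Ax Γ (.imp χ ψ) :=
  mp h₁ (mp h₂ (ipc (.s χ φ ψ)))

theorem imp_self (φ : Fml) : Deriv Ax Γ (.imp φ φ) :=
  imp_mp (ψ := φ) (ipc (.k φ φ)) (ipc (.k φ (.imp φ φ)))

theorem and_intro (h₁ : Deriv Ax Γ φ) (h₂ : Deriv Ax Γ ψ) : Deriv Ax Γ (.and φ ψ) :=
  mp h₂ (mp h₁ (ipc (.andI φ ψ)))

/-- The deduction theorem. -/
theorem deduction (h : Deriv Ax (insert χ Γ) φ) : Deriv Ax Γ (.imp χ φ) := by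
  generalize hΔ : insert χ Γ = Δ at h
  induction h with
  | base h => exact imp_intro χ (base h)
  | axm σ h => exact imp_intro χ (axm σ h)
  | el h =>
    subst hΔ
    rcases h with rfl | h
    · exact imp_self _
    · exact imp_intro χ (el h)
  | mp _ _ ih₁ ih₂ => exact imp_mp (ih₁ hΔ) (ih₂ hΔ)
  | na h _ => exact imp_intro χ (na h)

theorem disj_elim {L : List Fml} (h : ∀ ψ ∈ L, Deriv Ax Γ (.imp ψ φ)) :
    Deriv Ax Γ (.imp (Fml.disj L) φ) := by
  induction L with
  | nil => exact ipc (.botE φ)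
  | cons ψ L ih =>
    cases L with
    | nil => exact h ψ (by simp)
    | cons χ L =>
      exact mp (ih fun θ hθ => h θ (List.mem_cons_of_mem _ hθ))
        (mp (h ψ (by simp)) (ipc (.orE ψ (Fml.disj (χ :: L)) φ)))

theorem sto_trans (h₁ : Deriv Ax Γ (.sto φ ψ)) (h₂ : Deriv Ax Γ (.sto ψ χ)) :
    Deriv Ax Γ (.sto φ χ) :=
  mp (and_intro h₁ h₂) (base (.tr φ ψ χ))

/-- `⊤⇛(·)` distributes over derivability. -/
theorem top_sto_of_deriv (h : Deriv Ax {ψ | Deriv Ax Γ (.sto .top ψ)} φ) :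
    Deriv Ax Γ (.sto .top φ) := by
  generalize hΔ : {ψ | Deriv Ax Γ (.sto .top ψ)} = Δ at h
  induction h with
  | base h => exact na (imp_intro _ (base h))
  | axm σ h => exact na (imp_intro _ (axm σ h))
  | el h => subst hΔ; exact h
  | @mp _ φ ψ _ _ ih₁ ih₂ =>
    have hand : Deriv Ax Γ (.sto .top (.and φ (.imp φ ψ))) :=
      mp (and_intro (ih₁ hΔ) (ih₂ hΔ)) (base (.ka _ _ _))
    exact sto_trans hand (na (imp_mp (ipc (.andE1 _ _)) (ipc (.andE2 _ _))))
  | na h _ => exact na (imp_intro _ (na h))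

/-- Compactness of derivability along nonempty chains. -/
theorem exists_of_sUnion {c : Set (Set Fml)} (hc : IsChain (· ⊆ ·) c) (hne : c.Nonempty)
    (h : Deriv Ax (⋃₀ c) φ) : ∃ X ∈ c, Deriv Ax X φ := by
  obtain ⟨X₀, hX₀⟩ := hne
  generalize hΔ : ⋃₀ c = Δ at h
  induction h with
  | base h => exact ⟨X₀, hX₀, base h⟩
  | axm σ h => exact ⟨X₀, hX₀, axm σ h⟩
  | el h =>
    subst hΔ
    obtain ⟨X, hX, hφ⟩ := h
    exact ⟨X, hX, el hφ⟩
  | mp _ _ ih₁ ih₂ =>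
    obtain ⟨X, hX, h₁⟩ := ih₁ hΔ
    obtain ⟨Y, hY, h₂⟩ := ih₂ hΔ
    rcases hc.total hX hY with h | h
    · exact ⟨Y, hY, mp (h₁.mono h) h₂⟩
    · exact ⟨X, hX, mp h₁ (h₂.mono h)⟩
  | na h _ => exact ⟨X₀, hX₀, na h⟩

end Deriv

/-- The prime extension lemma. -/
theorem exists_primeTheoryIn {Ax S T : Set Fml} {φ : Fml} (hφ : ¬ Deriv Ax T φ) :
    ∃ Θ, PrimeTheoryIn Ax S Θ ∧ T ∩ S ⊆ Θ ∧ φ ∉ Θ := by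
  obtain ⟨X, hTX, hX⟩ := zorn_subset_nonempty {X : Set Fml | ¬ Deriv Ax X φ}
    (fun c hcs hc hne => ⟨⋃₀ c, fun h => by
      obtain ⟨X, hX, hd⟩ := Deriv.exists_of_sUnion hc hne h
      exact hcs hX hd, fun _ => Set.subset_sUnion_of_mem⟩) T hφ
  have hXφ : ¬ Deriv Ax X φ := hX.prop
  have himp : ∀ ψ, ψ ∉ X → Deriv Ax X (.imp ψ φ) := by
    intro ψ hψ
    refine Deriv.deduction (by_contra fun hd => hψ ?_)
    exact hX.le_of_ge hd (Set.subset_insert ψ X) (Set.mem_insert ψ X)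
  refine ⟨X ∩ S, ⟨Set.inter_subset_right, ?_, ?_, ?_⟩,
    Set.inter_subset_inter_left S hTX, fun h => hXφ (.el h.1)⟩
  · intro ψ hψS hψ
    refine ⟨by_contra fun hψX => hXφ ?_, hψS⟩
    exact .mp (hψ.mono Set.inter_subset_left) (himp ψ hψX)
  · intro h
    exact hXφ (.mp (h.mono Set.inter_subset_left) (.ipc (.botE φ)))
  · intro L _ hLS hL
    by_contra! hno
    refine hXφ (.mp (hL.mono Set.inter_subset_left) (Deriv.disj_elim fun ψ hψ => himp ψ ?_))
    exact fun hψX => hno ψ hψ ⟨hψX, hLS ψ hψ⟩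

namespace PrimeTheoryIn

variable {Ax S Γ Γ' : Set Fml}

theorem mem_or_neg_mem (hΓ : PrimeTheoryIn Ax S Γ) (hem : emFml ∈ Ax) {φ : Fml}
    (hφ : φ ∈ S) (hnφ : Fml.imp φ .bot ∈ S) : φ ∈ Γ ∨ Fml.imp φ .bot ∈ Γ := by
  have hd : Deriv Ax Γ (Fml.disj [φ, .imp φ .bot]) := .axm (fun _ => φ) hem
  simpa using hΓ.2.2.2 [φ, .imp φ .bot] (by simp) (by simp [hφ, hnφ]) hd

theorem not_neg_mem (hΓ : PrimeTheoryIn Ax S Γ) {φ : Fml} (hφ : φ ∈ Γ) :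
    Fml.imp φ .bot ∉ Γ :=
  fun h => hΓ.2.2.1 (.mp (.el hφ) (.el h))

/-- Under excluded middle, every prime theory is maximal. -/
theorem subset_of_subset (hΓ : PrimeTheoryIn Ax S Γ) (hΓ' : PrimeTheoryIn Ax S Γ')
    (hsub : SubfClosed S) (hsn : SnClosed S) (hem : emFml ∈ Ax) (h : Γ ⊆ Γ') : Γ' ⊆ Γ := by
  intro φ hφ
  have hφS := hΓ'.1 hφ
  by_cases hneg : ∃ ψ, φ = .imp ψ .bot
  · obtain ⟨ψ, rfl⟩ := hneg
    refine (hΓ.mem_or_neg_mem hem (hsub.2.2.1 _ _ hφS).1 hφS).resolve_left fun hψ => ?_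
    exact hΓ'.not_neg_mem (h hψ) hφ
  · have hnφ : Fml.imp φ .bot ∈ S := by
      have hs := hsn φ hφS
      unfold Fml.sneg at hs
      split at hs
      · exact absurd ⟨_, rfl⟩ hneg
      · exact hs
    exact (hΓ.mem_or_neg_mem hem hφS hnφ).resolve_right fun hn => hΓ'.not_neg_mem hφ (h hn)

theorem top_mem (hΓ : PrimeTheoryIn Ax S Γ) (htop : Fml.top ∈ S) : Fml.top ∈ Γ :=
  hΓ.2.1 _ htop (.ipc .top)

/-- The largest segment headed by `Γ`. -/
theorem isSegment_top_sto (hΓ : PrimeTheoryIn Ax S Γ) :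
    IsSegment Ax S Γ
      {Θ | PrimeTheoryIn Ax S Θ ∧ {ψ | Deriv Ax Γ (.sto .top ψ)} ∩ S ⊆ Θ} := by
  refine ⟨hΓ, fun Δ hΔ => hΔ.1, fun Δ hΔ Δ' hΔ' hsub => ⟨hΔ', hΔ.2.trans hsub⟩, ?_⟩
  intro φ ψ _ hψ hd hall Δ hΔ
  have hφ : Deriv Ax {ψ | Deriv Ax Γ (.sto .top ψ)} φ := by
    by_contra hnd
    obtain ⟨Θ, hΘ, hsub, hφΘ⟩ := exists_primeTheoryIn (S := S) hnd
    exact hφΘ (hall Θ ⟨hΘ, hsub⟩)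
  exact hΔ.2 ⟨Deriv.sto_trans (Deriv.top_sto_of_deriv hφ) hd, hψ⟩

end PrimeTheoryIn

theorem IsSegment.mem_of_deriv_top_sto {Ax S Γ Δ : Set Fml} {U : Set (Set Fml)}
    (h : IsSegment Ax S Γ U) (htop : Fml.top ∈ S) {φ : Fml} (hφ : φ ∈ S)
    (hd : Deriv Ax Γ (.sto .top φ)) (hΔ : Δ ∈ U) : φ ∈ Δ :=
  h.2.2.2 _ _ htop hφ hd (fun Θ hΘ => (h.2.1 Θ hΘ).top_mem htop) Δ hΔ

/-- properties of the full canonical frame `F_{Ax,Σ}`, whose worlds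
are the `(Ax,Σ)`-segments, with `(Γ,U) ≼ (Γ',U')` iff `Γ ⊆ Γ'` and
`(Γ,U) R (Γ',U')` iff `Γ' ∈ U`. -/
theorem canonical_frame_properties (Ax S : Set Fml) (hcon : Consistent Ax)
    (htop : Fml.top ∈ S) (hsub : SubfClosed S) :
    (SnClosed S → emFml ∈ Ax →
      ∀ w v : Segment Ax S, w.1.1 ⊆ v.1.1 → v.1.1 ⊆ w.1.1) ∧
    (tbFml ∈ Ax →
      ∀ w : Segment Ax S, ∃ v : Segment Ax S, w.1.1 ⊆ v.1.1 ∧ w.1.1 ∈ v.1.2) ∧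
    (strFml ∈ Ax →
      ∀ w v : Segment Ax S, v.1.1 ∈ w.1.2 → w.1.1 ⊆ v.1.1) ∧
    (S = Set.univ → paFml ∈ Ax →
      ∀ w v s : Segment Ax S, v.1.1 ∈ w.1.2 → s.1.1 ∈ v.1.2 →
        ∃ u : Segment Ax S, w.1.1 ⊆ u.1.1 ∧ s.1.1 ∈ u.1.2 ∧
          ∀ t : Segment Ax S, t.1.1 ∈ u.1.2 → t.1.1 ∈ v.1.2) := by
  refine ⟨fun hsn hem w v h => ?_, fun htb w => ?_, fun hstr w v h φ hφ => ?_, ?_⟩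
  · exact w.2.1.subset_of_subset v.2.1 hsub hsn hem h
  · refine ⟨⟨(w.1.1, {Θ | PrimeTheoryIn Ax S Θ ∧
      {ψ | Deriv Ax w.1.1 (.sto .top ψ)} ∩ S ⊆ Θ}), w.2.1.isSegment_top_sto⟩,
      subset_rfl, w.2.1, ?_⟩
    rintro ψ ⟨hψ, hψS⟩
    exact w.2.1.2.1 ψ hψS (.mp hψ (.axm (fun _ => ψ) htb))
  · refine w.2.mem_of_deriv_top_sto htop (w.2.1.1 hφ) ?_ h
    exact .mp (Deriv.imp_intro .top (.el hφ))
      (.axm (fun n => if n = 0 then .top else φ) hstr)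
  · rintro rfl hpa w v s hwv hvs
    refine ⟨⟨(w.1.1, v.1.2), w.2.1, v.2.2.1, v.2.2.2.1, ?_⟩, subset_rfl, hvs,
      fun _ => id⟩
    intro φ ψ hφ hψ hd
    refine v.2.2.2.2 φ ψ hφ hψ (.el (w.2.mem_of_deriv_top_sto htop trivial ?_ hwv))
    exact .mp hd (.axm (fun n => if n = 0 then φ else ψ) hpa)
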